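/- Let ε ≥ 0, T > 0, and let u₁, u₂ : [0, T] × 𝕋 → ℂ be a classical solution of the regularized system with pressure law p(z) = −z + |z|²z, i.e. u₁, u₂, ∂ₜu₁, ∂ₜu₂, ∂ₓu₁, ∂ₓu₂ and ∂ₓ²u₂ exist and are continuous on [0, T] × 𝕋 and ∂ₜu₁ + ∂ₓu₂ = 0 and ∂ₜu₂ + ∂ₓ(−u₁ + |u₁|²u₁) + iε∂ₓ²u₂ = 0 hold pointwise. Then the energy t ↦ ∫_𝕋 ( ¼|u₁(t,x)|⁴ − ½|u₁(t,x)|² + ½|u₂(t,x)|² ) dx is constant on [0, T]. -/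

import Mathlib

open MeasureTheory Filter

noncomputable section

/-- A quantity whose density has time derivative `g` in divergence form `g = ∂ₓ F`, with equal
fluxes through both ends of `[0, L]`, is conserved. -/
theorem integral_eq_of_hasDerivAt_flux {T L : ℝ} {e g F : ℝ → ℝ → ℝ}
    (he : ContinuousOn (fun q : ℝ × ℝ => e q.1 q.2) (Set.Icc 0 T ×ˢ Set.univ))
    (hg : ContinuousOn (fun q : ℝ × ℝ => g q.1 q.2) (Set.Icc 0 T ×ˢ Set.univ))
    (het : ∀ t ∈ Set.Ioo (0:ℝ) T, ∀ x, HasDerivAt (fun s => e s x) (g t x) t)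
    (hF : ∀ t ∈ Set.Icc (0:ℝ) T, ∀ x, HasDerivAt (F t) (g t x) x)
    (hFL : ∀ t ∈ Set.Icc (0:ℝ) T, F t L = F t 0) {t : ℝ} (ht : t ∈ Set.Icc (0:ℝ) T) :
    ∫ x in (0:ℝ)..L, e t x = ∫ x in (0:ℝ)..L, e 0 x := by
  have h0 : (0:ℝ) ∈ Set.Icc (0:ℝ) T := ⟨le_rfl, ht.1.trans ht.2⟩
  have slice_x : ∀ {f : ℝ → ℝ → ℝ},
      ContinuousOn (fun q : ℝ × ℝ => f q.1 q.2) (Set.Icc 0 T ×ˢ Set.univ) →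
      ∀ s ∈ Set.Icc (0:ℝ) T, Continuous (f s) := fun hf s hs =>
    hf.comp_continuous (Continuous.prodMk_right s) fun _ => ⟨hs, trivial⟩
  have slice_t : ∀ {f : ℝ → ℝ → ℝ},
      ContinuousOn (fun q : ℝ × ℝ => f q.1 q.2) (Set.Icc 0 T ×ˢ Set.univ) →
      ∀ x, ContinuousOn (fun s => f s x) (Set.Icc 0 t) := fun hf x =>
    hf.comp (f := fun s => (s, x)) (by fun_prop) fun _ hs => ⟨⟨hs.1, hs.2.trans ht.2⟩, trivial⟩
  have hint : ∀ x, ∫ s in (0:ℝ)..t, g s x = e t x - e 0 x := fun x =>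
    intervalIntegral.integral_eq_sub_of_hasDerivAt_of_le ht.1 (slice_t he x)
      (fun s hs => het s ⟨hs.1, hs.2.trans_le ht.2⟩ x)
      ((slice_t hg x).intervalIntegrable_of_Icc ht.1)
  have hflux : ∀ s ∈ Set.Icc (0:ℝ) T, ∫ x in (0:ℝ)..L, g s x = 0 := fun s hs => by
    rw [intervalIntegral.integral_eq_sub_of_hasDerivAt (fun x _ => hF s hs x)
      ((slice_x hg s hs).intervalIntegrable _ _), hFL s hs, sub_self]
  have hgint : IntegrableOn (Function.uncurry g) (Set.uIcc 0 t ×ˢ Set.uIcc 0 L) := by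
    refine ContinuousOn.integrableOn_compact (isCompact_uIcc.prod isCompact_uIcc) (hg.mono ?_)
    rw [Set.uIcc_of_le ht.1]
    exact Set.prod_mono (Set.Icc_subset_Icc_right ht.2) (Set.subset_univ _)
  have hswap : ∫ s in (0:ℝ)..t, ∫ x in (0:ℝ)..L, g s x
      = ∫ x in (0:ℝ)..L, ∫ s in (0:ℝ)..t, g s x := by
    apply intervalIntegral_intervalIntegral_swap
    exact hgint.mono_set (Set.prod_mono Set.uIoc_subset_uIcc Set.uIoc_subset_uIcc)
  have hzero : ∫ s in (0:ℝ)..t, ∫ x in (0:ℝ)..L, g s x = 0 := by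
    rw [intervalIntegral.integral_congr (g := fun _ => (0:ℝ)), intervalIntegral.integral_zero]
    intro s hs
    rw [Set.uIcc_of_le ht.1] at hs
    exact hflux s ⟨hs.1, hs.2.trans ht.2⟩
  rw [hswap, intervalIntegral.integral_congr (fun x _ => hint x),
    intervalIntegral.integral_sub ((slice_x he t ht).intervalIntegrable _ _)
      ((slice_x he 0 h0).intervalIntegrable _ _)] at hzero
  exact sub_eq_zero.mp hzero

/-- The derivative of a periodic function is periodic. -/
theorem Function.Periodic.of_hasDerivAt {f f' : ℝ → ℂ} {c : ℝ} (hf : Function.Periodic f c)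
    (hd : ∀ x, HasDerivAt f (f' x) x) : Function.Periodic f' c := fun x => by
  have h := (hd (x + c)).comp_add_const x c
  rw [show (fun y => f (y + c)) = f from funext hf] at h
  exact h.unique (hd x)

/-- Energy conservation for classical solutions of the regularized system with
pressure law `p(z) = −z + |z|²z`. -/
theorem energy_conservation_p1 (ε T : ℝ) (hε : 0 ≤ ε) (hT : 0 < T)
    (u₁ u₂ d₁t d₂t d₁x d₂x d₂xx dpx : ℝ → ℝ → ℂ)
    (hper₁ : ∀ t ∈ Set.Icc (0:ℝ) T, Function.Periodic (u₁ t) (2 * Real.pi))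
    (hper₂ : ∀ t ∈ Set.Icc (0:ℝ) T, Function.Periodic (u₂ t) (2 * Real.pi))
    (hu₁ : ContinuousOn (fun q : ℝ × ℝ => u₁ q.1 q.2) (Set.Icc 0 T ×ˢ Set.univ))
    (hu₂ : ContinuousOn (fun q : ℝ × ℝ => u₂ q.1 q.2) (Set.Icc 0 T ×ˢ Set.univ))
    (hc₁t : ContinuousOn (fun q : ℝ × ℝ => d₁t q.1 q.2) (Set.Icc 0 T ×ˢ Set.univ))
    (hc₂t : ContinuousOn (fun q : ℝ × ℝ => d₂t q.1 q.2) (Set.Icc 0 T ×ˢ Set.univ))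
    (hc₁x : ContinuousOn (fun q : ℝ × ℝ => d₁x q.1 q.2) (Set.Icc 0 T ×ˢ Set.univ))
    (hc₂x : ContinuousOn (fun q : ℝ × ℝ => d₂x q.1 q.2) (Set.Icc 0 T ×ˢ Set.univ))
    (hc₂xx : ContinuousOn (fun q : ℝ × ℝ => d₂xx q.1 q.2) (Set.Icc 0 T ×ˢ Set.univ))
    (hd₁t : ∀ t ∈ Set.Icc (0:ℝ) T, ∀ x : ℝ,
      HasDerivWithinAt (fun s => u₁ s x) (d₁t t x) (Set.Icc 0 T) t)
    (hd₂t : ∀ t ∈ Set.Icc (0:ℝ) T, ∀ x : ℝ,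
      HasDerivWithinAt (fun s => u₂ s x) (d₂t t x) (Set.Icc 0 T) t)
    (hd₁x : ∀ t ∈ Set.Icc (0:ℝ) T, ∀ x : ℝ, HasDerivAt (fun y => u₁ t y) (d₁x t x) x)
    (hd₂x : ∀ t ∈ Set.Icc (0:ℝ) T, ∀ x : ℝ, HasDerivAt (fun y => u₂ t y) (d₂x t x) x)
    (hd₂xx : ∀ t ∈ Set.Icc (0:ℝ) T, ∀ x : ℝ, HasDerivAt (fun y => d₂x t y) (d₂xx t x) x)
    (hdpx : ∀ t ∈ Set.Icc (0:ℝ) T, ∀ x : ℝ,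
      HasDerivAt (fun y => -u₁ t y + (‖u₁ t y‖ : ℂ) ^ 2 * u₁ t y) (dpx t x) x)
    (heq₁ : ∀ t ∈ Set.Icc (0:ℝ) T, ∀ x : ℝ, d₁t t x + d₂x t x = 0)
    (heq₂ : ∀ t ∈ Set.Icc (0:ℝ) T, ∀ x : ℝ,
      d₂t t x + dpx t x + Complex.I * (ε:ℂ) * d₂xx t x = 0) :
    ∀ t ∈ Set.Icc (0:ℝ) T,
      (∫ x in (0:ℝ)..(2 * Real.pi),
        ((1:ℝ) / 4 * ‖u₁ t x‖ ^ 4 - 1 / 2 * ‖u₁ t x‖ ^ 2 + 1 / 2 * ‖u₂ t x‖ ^ 2))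
      = ∫ x in (0:ℝ)..(2 * Real.pi),
        ((1:ℝ) / 4 * ‖u₁ 0 x‖ ^ 4 - 1 / 2 * ‖u₁ 0 x‖ ^ 2 + 1 / 2 * ‖u₂ 0 x‖ ^ 2) := by
  set p : ℝ → ℝ → ℂ := fun t x => -u₁ t x + (‖u₁ t x‖ : ℂ) ^ 2 * u₁ t x with hp
  refine fun t ht => integral_eq_of_hasDerivAt_flux (T := T)
    (e := fun t x => (1:ℝ) / 4 * ‖u₁ t x‖ ^ 4 - 1 / 2 * ‖u₁ t x‖ ^ 2 + 1 / 2 * ‖u₂ t x‖ ^ 2)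
    (g := fun t x => inner ℝ (p t x) (d₁t t x) + inner ℝ (u₂ t x) (d₂t t x))
    (F := fun t x => -inner ℝ (p t x) (u₂ t x) - ε * inner ℝ (u₂ t x) (Complex.I * d₂x t x))
    ?_ ?_ ?_ ?_ ?_ ht
  · fun_prop
  · have hpc : ContinuousOn (fun q : ℝ × ℝ => p q.1 q.2) (Set.Icc 0 T ×ˢ Set.univ) :=
      hu₁.neg.add (((Complex.continuous_ofReal.comp_continuousOn hu₁.norm).pow 2).mul hu₁)
    exact (hpc.inner (𝕜 := ℝ) hc₁t).add (hu₂.inner (𝕜 := ℝ) hc₂t)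
  · intro s hs x
    have hmem := Icc_mem_nhds hs.1 hs.2
    have hs' := Set.Ioo_subset_Icc_self hs
    have h1 := ((hd₁t s hs' x).hasDerivAt hmem).norm_sq
    have h2 := ((hd₂t s hs' x).hasDerivAt hmem).norm_sq
    have h := (((h1.pow 2).const_mul (1 / 4 : ℝ)).sub (h1.const_mul (1 / 2 : ℝ))).add
      (h2.const_mul (1 / 2 : ℝ))
    refine (h.congr_deriv ?_).congr_of_eventuallyEq (.of_forall fun y => ?_)
    · simp [hp, Complex.inner, ← Complex.ofReal_pow]
      ring
    · simp
      ring
  · intro s hs x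
    have h := ((hdpx s hs x).inner ℝ (hd₂x s hs x)).neg.sub
      (((hd₂x s hs x).inner ℝ ((hd₂xx s hs x).const_mul Complex.I)).const_mul ε)
    refine h.congr_deriv ?_
    have h1 : d₁t s x = -d₂x s x := eq_neg_of_add_eq_zero_left (heq₁ s hs x)
    have h2 : d₂t s x = -(dpx s x + Complex.I * (ε:ℂ) * d₂xx s x) :=
      eq_neg_of_add_eq_zero_left (by rw [← add_assoc]; exact heq₂ s hs x)
    rw [h1, h2]
    simp [hp, Complex.inner, ← Complex.ofReal_pow]
    ring
  · intro s hs
    have hd := (hper₂ s hs).of_hasDerivAt (hd₂x s hs)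
    simp only [hp, (hper₁ s hs).eq, (hper₂ s hs).eq, hd.eq]
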